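/- arXiv:2104.05065 — 2 statements merged into one kernel-verified Lean document; each statement's English description precedes it below -/
import Mathlib

section
/- Let R = (V, Z, O, r) be an instance over the Horn template Γ = ({0,1}, {(0)}, {(1)}, ϱ_{x∧y→z}), and let R' = (V, Z', O', r') be the densification of (R, Γ), i.e. the unique maximal instance with Z' ⊇ Z, O' ⊇ O, r' ⊇ r and Hom(R', Γ) = Hom(R, Γ). If Hom(R, Γ) ≠ ∅, then Z' = {v ∈ V : o_Σ({v} ∪ O) ∩ Z ≠ ∅}. -/
/-- Homomorphisms from the instance `(V, Z, O, r)` to the Horn template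
`({0,1}, {(0)}, {(1)}, ϱ_{x∧y→z})`. -/
def HornHom {V : Type*} (Z O : Set V) (r : Set (V × V × V)) : Set (V → Bool) :=
  {h | (∀ v ∈ Z, h v = false) ∧ (∀ v ∈ O, h v = true) ∧
       ∀ c ∈ r, (h c.1 && h c.2.1) ≤ h c.2.2}

/-- The closure `o_Σ(S)`: the smallest `T ⊇ S` such that `(i,j,k) ∈ r` and `i, j ∈ T`
imply `k ∈ T`. -/
def hornClosure {V : Type*} (r : Set (V × V × V)) (S : Set V) : Set V :=
  ⋂₀ {T : Set V | S ⊆ T ∧ ∀ i j k : V, (i, j, k) ∈ r → i ∈ T → j ∈ T → k ∈ T}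

theorem subset_hornClosure {V : Type*} (r : Set (V × V × V)) (S : Set V) :
    S ⊆ hornClosure r S :=
  Set.subset_sInter fun _ hT => hT.1

theorem hornClosure_closed {V : Type*} {r : Set (V × V × V)} {S : Set V} {i j k : V}
    (hc : (i, j, k) ∈ r) (hi : i ∈ hornClosure r S) (hj : j ∈ hornClosure r S) :
    k ∈ hornClosure r S :=
  fun T hT => hT.2 i j k hc (hi T hT) (hj T hT)

theorem hornClosure_subset {V : Type*} {r : Set (V × V × V)} {S T : Set V} (hS : S ⊆ T)
    (hT : ∀ i j k : V, (i, j, k) ∈ r → i ∈ T → j ∈ T → k ∈ T) : hornClosure r S ⊆ T :=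
  Set.sInter_subset_of_mem ⟨hS, hT⟩

/-- The indicator of a closure containing `O` and avoiding `Z` is a homomorphism. -/
theorem exists_hornHom_iff_mem_hornClosure {V : Type*} {Z O : Set V} {r : Set (V × V × V)}
    {S : Set V} (hO : O ⊆ S) (hZ : hornClosure r S ∩ Z = ∅) :
    ∃ h ∈ HornHom Z O r, ∀ v, h v = true ↔ v ∈ hornClosure r S := by
  classical
  refine ⟨fun v => decide (v ∈ hornClosure r S), ⟨fun v hv => ?_, fun v hv => ?_, ?_⟩,
    fun v => decide_eq_true_iff⟩
  · exact decide_eq_false fun hvS => (Set.mem_empty_iff_false v).1 (hZ ▸ ⟨hvS, hv⟩)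
  · exact decide_eq_true (subset_hornClosure r S (hO hv))
  · rintro ⟨i, j, k⟩ hc
    rw [Bool.le_iff_imp]
    simp only [Bool.and_eq_true, decide_eq_true_eq]
    exact fun hij => hornClosure_closed hc hij.1 hij.2

/-- A homomorphism that is `true` on `S` is `true` on the closure of `S`. -/
theorem HornHom.eq_true_of_mem_hornClosure {V : Type*} {Z O : Set V} {r : Set (V × V × V)}
    {S : Set V} {h : V → Bool} (hh : h ∈ HornHom Z O r) (hS : ∀ v ∈ S, h v = true) {v : V}
    (hv : v ∈ hornClosure r S) : h v = true := by
  refine hornClosure_subset (T := {v | h v = true}) hS (fun i j k hc hi hj => ?_) hv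
  exact Bool.le_iff_imp.1 (hh.2.2 _ hc) (Bool.and_eq_true_iff.2 ⟨hi, hj⟩)

/-- If `(V, Z', O', r')` is the densification of `(V, Z, O, r)` over the Horn template and
there is at least one homomorphism, then `Z' = {v : o_Σ({v} ∪ O) ∩ Z ≠ ∅}`. -/
theorem stmt10 {V : Type*} (Z O : Set V) (r : Set (V × V × V))
    (Z' O' : Set V) (r' : Set (V × V × V))
    (hZ : Z ⊆ Z') (hO : O ⊆ O') (hr : r ⊆ r')
    (hHom : HornHom Z' O' r' = HornHom Z O r)
    (hMax : ∀ (Z'' O'' : Set V) (r'' : Set (V × V × V)),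
      Z' ⊆ Z'' → O' ⊆ O'' → r' ⊆ r'' →
      HornHom Z'' O'' r'' = HornHom Z' O' r' → Z'' = Z' ∧ O'' = O' ∧ r'' = r')
    (hne : (HornHom Z O r).Nonempty) :
    Z' = {v : V | hornClosure r (insert v O) ∩ Z ≠ ∅} := by
  ext v
  simp only [Set.mem_ofPred_eq]
  constructor
  · intro hv hempty
    obtain ⟨h, hh, hiff⟩ := exists_hornHom_iff_mem_hornClosure (Set.subset_insert v O) hempty
    have htrue := (hiff v).2 (subset_hornClosure r _ (Set.mem_insert v O))
    rw [← hHom] at hh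
    simp [hh.1 v hv] at htrue
  · intro hv
    obtain ⟨z, hzcl, hz⟩ := Set.nonempty_iff_ne_empty.2 hv
    have hfalse : ∀ h ∈ HornHom Z' O' r', h v = false := by
      intro h hh
      rw [hHom] at hh
      by_contra hne'
      have hzt : h z = true := HornHom.eq_true_of_mem_hornClosure hh
        (Set.forall_mem_insert.2 ⟨Bool.eq_true_of_not_eq_false hne', hh.2.1⟩) hzcl
      simp [hh.1 z hz] at hzt
    have hsame : HornHom (insert v Z') O' r' = HornHom Z' O' r' := Set.Subset.antisymm
      (fun h hh => ⟨fun w hw => hh.1 w (Set.mem_insert_of_mem v hw), hh.2⟩)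
      (fun h hh => ⟨Set.forall_mem_insert.2 ⟨hfalse h hh, hh.1⟩, hh.2⟩)
    rw [← (hMax _ O' r' (Set.subset_insert v Z') subset_rfl subset_rfl hsame).1]
    exact Set.mem_insert v Z'
end

section
/- Let R = (V, r_1, ..., r_s) and Γ = (D, ρ_1, ..., ρ_s) be relational structures over a common signature and let L be a finite set of Horn rules over the signature. Then: (i) the family of structures T = (V, t_1, ..., t_s) with t_i ⊇ r_i for all i that satisfy every rule in L has a least element R^L = (V, r^L_1, ..., r^L_s) with respect to componentwise inclusion; (ii) if Γ satisfies every rule in L and R' = (V, r'_1, ..., r'_s) is the densification of (R, Γ) — i.e. the unique maximal instance with r'_i ⊇ r_i and Hom(R', Γ) = Hom(R, Γ) — then r^L_i ⊆ r'_i for every i ∈ [s]. -/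
/-- A Horn rule over the signature with `s` relation symbols of arities `arity i`. -/
structure HornRule (s : ℕ) (arity : Fin s → ℕ) where
  n : ℕ
  u : Fin s
  head_le : arity u ≤ n
  N : ℕ
  j : Fin N → Fin s
  o : ∀ t : Fin N, Fin (arity (j t)) → Fin n

/-- A structure `(W, t)` satisfies the Horn rule `Ψ`. -/
def SatisfiesHorn {s : ℕ} {arity : Fin s → ℕ} {W : Type*}
    (t : ∀ i : Fin s, Set (Fin (arity i) → W)) (Ψ : HornRule s arity) : Prop :=
  ∀ a : Fin Ψ.n → W,
    (∀ k : Fin Ψ.N, (fun q => a (Ψ.o k q)) ∈ t (Ψ.j k)) →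
    (fun q : Fin (arity Ψ.u) => a (Fin.castLE Ψ.head_le q)) ∈ t Ψ.u

/-- The set of homomorphisms from `(V, r)` to `(D, ρ)`. -/
def Hom {s : ℕ} {arity : Fin s → ℕ} {V D : Type*}
    (r : ∀ i : Fin s, Set (Fin (arity i) → V))
    (ρ : ∀ i : Fin s, Set (Fin (arity i) → D)) : Set (V → D) :=
  {h | ∀ i : Fin s, ∀ t ∈ r i, (fun k => h (t k)) ∈ ρ i}

/-- The instance `((V, r), (D, ρ))` is maximal. -/
def IsMaximal {s : ℕ} {arity : Fin s → ℕ} {V D : Type*}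
    (r : ∀ i : Fin s, Set (Fin (arity i) → V))
    (ρ : ∀ i : Fin s, Set (Fin (arity i) → D)) : Prop :=
  ∀ r' : ∀ i : Fin s, Set (Fin (arity i) → V),
    (∀ i, r i ⊆ r' i) → Hom r' ρ = Hom r ρ → r' = r

/-- In a maximal instance, a tuple belongs to a relation as soon as every homomorphism sends it
into the corresponding relation of the template. -/
theorem IsMaximal.mem_of_forall_hom {s : ℕ} {arity : Fin s → ℕ} {V D : Type*}
    {r : ∀ i : Fin s, Set (Fin (arity i) → V)} {ρ : ∀ i : Fin s, Set (Fin (arity i) → D)}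
    (hmax : IsMaximal r ρ) {i : Fin s} {x : Fin (arity i) → V}
    (hx : ∀ h ∈ Hom r ρ, (fun k => h (x k)) ∈ ρ i) : x ∈ r i := by
  let c : ∀ i : Fin s, Set (Fin (arity i) → V) :=
    fun i => {y | ∀ h ∈ Hom r ρ, (fun k => h (y k)) ∈ ρ i}
  have hrc : ∀ i, r i ⊆ c i := fun i y hy h hh => hh i y hy
  have hc : c = r := hmax c hrc <| Set.Subset.antisymm
    (fun h hh i y hy => hh i y (hrc i hy)) (fun h hh i y hy => hy h hh)
  exact hc ▸ (show x ∈ c i from hx)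

/-- A maximal instance satisfies every Horn rule satisfied by the template. -/
theorem IsMaximal.satisfiesHorn {s : ℕ} {arity : Fin s → ℕ} {V D : Type*}
    {r : ∀ i : Fin s, Set (Fin (arity i) → V)} {ρ : ∀ i : Fin s, Set (Fin (arity i) → D)}
    (hmax : IsMaximal r ρ) {Ψ : HornRule s arity} (hΨ : SatisfiesHorn ρ Ψ) :
    SatisfiesHorn r Ψ := fun a ha =>
  hmax.mem_of_forall_hom fun h hh => hΨ (fun q => h (a q)) fun k => hh _ _ (ha k)

/-- (i) Among the componentwise supersets of `r` satisfying every Horn rule of the finite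
list `L` there is a least one, `r^L`; (ii) if the template satisfies every rule of `L`
and `r'` is the densification of `(R, Γ)` (the unique maximal instance with `r'ᵢ ⊇ rᵢ`
and the same homomorphisms), then `r^Lᵢ ⊆ r'ᵢ` for every `i`. -/
theorem stmt19 {s : ℕ} {arity : Fin s → ℕ} {V D : Type*}
    (r : ∀ i : Fin s, Set (Fin (arity i) → V))
    (ρ : ∀ i : Fin s, Set (Fin (arity i) → D))
    (L : List (HornRule s arity)) :
    ∃ rL : ∀ i : Fin s, Set (Fin (arity i) → V),
      ((∀ i, r i ⊆ rL i) ∧ (∀ Ψ ∈ L, SatisfiesHorn rL Ψ)) ∧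
      (∀ t : ∀ i : Fin s, Set (Fin (arity i) → V),
        (∀ i, r i ⊆ t i) → (∀ Ψ ∈ L, SatisfiesHorn t Ψ) → ∀ i, rL i ⊆ t i) ∧
      ((∀ Ψ ∈ L, SatisfiesHorn ρ Ψ) →
        ∀ r' : ∀ i : Fin s, Set (Fin (arity i) → V),
          (∀ i, r i ⊆ r' i) → Hom r' ρ = Hom r ρ → IsMaximal r' ρ →
          ∀ i, rL i ⊆ r' i) := by
  let rL : ∀ i : Fin s, Set (Fin (arity i) → V) :=
    fun i => {x | ∀ t : ∀ i : Fin s, Set (Fin (arity i) → V), (∀ i, r i ⊆ t i) →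
      (∀ Ψ ∈ L, SatisfiesHorn t Ψ) → x ∈ t i}
  have least : ∀ t : ∀ i : Fin s, Set (Fin (arity i) → V), (∀ i, r i ⊆ t i) →
      (∀ Ψ ∈ L, SatisfiesHorn t Ψ) → ∀ i, rL i ⊆ t i :=
    fun t hrt ht i x hx => hx t hrt ht
  refine ⟨rL, ⟨fun i x hx t hrt _ => hrt i hx, fun Ψ hΨ a ha t hrt ht => ?_⟩, least, ?_⟩
  · exact ht Ψ hΨ a fun k => ha k t hrt ht
  · exact fun hρ r' hr' _ hmax => least r' hr' fun Ψ hΨ => hmax.satisfiesHorn (hρ Ψ hΨ)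
end
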